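/- Let Δ be a simplicial complex on [n], 1 ≤ i < j ≤ n, and σ_(i,d) = {i−d+1, …, i}. Then rank(M_{σ_(i,d)}(J_{Shift_{ij}(Δ)}, d)) ≤ rank(M_{σ_(i,d)}(J_Δ, d)). -/

import Mathlib

/-- The exterior algebra `E = ⋀ V` of an `n`-dimensional `K`-vector space `V`
with distinguished basis `e_1, …, e_n` (modeled on `V = Fin n → K`). -/
abbrev ExtAlg (K : Type) [Field K] (n : ℕ) := ExteriorAlgebra K (Fin n → K)

/-- The monomial `e_σ = e_{j_1} ∧ ⋯ ∧ e_{j_d}` for `σ = {j_1 < ⋯ < j_d} ⊆ [n]`. -/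
noncomputable def eMon (K : Type) [Field K] (n : ℕ) (σ : Finset (Fin n)) : ExtAlg K n :=
  ((σ.sort (· ≤ ·)).map fun k => ExteriorAlgebra.ι K (Pi.single k (1 : K))).prod

/-- The span of the degree-`d` monomials: the image of `⋀^d V` in `E`. -/
noncomputable def monSpan (K : Type) [Field K] (n : ℕ) (d : ℕ) :
    Submodule K (ExtAlg K n) :=
  Submodule.span K {x | ∃ σ : Finset (Fin n), σ.card = d ∧ x = eMon K n σ}

/-- A subspace of `E` is a (two-sided) ideal. -/
def IsIdealE {K : Type} [Field K] {n : ℕ} (I : Submodule K (ExtAlg K n)) : Prop :=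
  ∀ x y : ExtAlg K n, y ∈ I → x * y ∈ I ∧ y * x ∈ I

/-- A subspace of `E` is (graded) homogeneous. -/
def IsHomogE {K : Type} [Field K] {n : ℕ} (I : Submodule K (ExtAlg K n)) : Prop :=
  I = ⨆ d : ℕ, I ⊓ monSpan K n d

/-- The two-sided ideal of `E` generated by a set. -/
noncomputable def idealSpanE (K : Type) [Field K] (n : ℕ) (s : Set (ExtAlg K n)) :
    Submodule K (ExtAlg K n) :=
  Submodule.span K {x | ∃ a ∈ s, ∃ u v : ExtAlg K n, x = u * a * v}

/-- The exterior face ideal `J_Δ ⊆ E`, generated by the monomials `e_σ`, `σ ∉ Δ`. -/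
noncomputable def faceIdealE (K : Type) [Field K] {n : ℕ} (Δ : Set (Finset (Fin n))) :
    Submodule K (ExtAlg K n) :=
  idealSpanE K n {x | ∃ σ : Finset (Fin n), σ ∉ Δ ∧ x = eMon K n σ}

/-- `e_τ ≤_rev e_σ` in the reverse lexicographic order induced by `e_1 > ⋯ > e_n`:
either `τ = σ`, or the largest element of the symmetric difference belongs to `τ`. -/
def revLexLe {n : ℕ} (τ σ : Finset (Fin n)) : Prop :=
  τ = σ ∨ ∃ k ∈ τ, k ∉ σ ∧ ∀ l ∈ σ, l ∉ τ → l < k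

/-- The span of the monomials `e_ρ` of degree `|σ|` with `e_ρ ≤_rev e_σ`. -/
noncomputable def monSpanLe (K : Type) [Field K] {n : ℕ} (σ : Finset (Fin n)) :
    Submodule K (ExtAlg K n) :=
  Submodule.span K
    {x | ∃ ρ : Finset (Fin n), ρ.card = σ.card ∧ revLexLe ρ σ ∧ x = eMon K n ρ}

/-- The span of the monomials `e_ρ` of degree `|σ|` with `e_ρ <_rev e_σ`. -/
noncomputable def monSpanLt (K : Type) [Field K] {n : ℕ} (σ : Finset (Fin n)) :
    Submodule K (ExtAlg K n) :=
  Submodule.span K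
    {x | ∃ ρ : Finset (Fin n), ρ.card = σ.card ∧ revLexLe ρ σ ∧ ρ ≠ σ ∧ x = eMon K n ρ}

/-- `e_σ` is the initial monomial (with respect to `<_rev`) of some element of `I`. -/
def IsInitialMonomial {K : Type} [Field K] {n : ℕ} (I : Submodule K (ExtAlg K n))
    (σ : Finset (Fin n)) : Prop :=
  ∃ f ∈ I, f ∈ monSpanLe K σ ∧ f ∉ monSpanLt K σ ∧ f ≠ 0

/-- The initial ideal `in_{<rev}(I)` of a homogeneous ideal `I ⊆ E`. -/
noncomputable def initialIdealE (K : Type) [Field K] {n : ℕ}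
    (I : Submodule K (ExtAlg K n)) : Submodule K (ExtAlg K n) :=
  Submodule.span K {x | ∃ σ : Finset (Fin n), IsInitialMonomial I σ ∧ x = eMon K n σ}

/-- The algebra automorphism of `E` induced by an (invertible) matrix `g`,
i.e. the action of `GL(n;K)` on `E`. -/
noncomputable def matAlgMap (K : Type) [Field K] {n : ℕ} (g : Matrix (Fin n) (Fin n) K) :
    ExtAlg K n →ₐ[K] ExtAlg K n :=
  ExteriorAlgebra.map (Matrix.toLin' g)

/-- The image `φ(I)` of a subspace `I ⊆ E` under the action of a matrix `φ = g`. -/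
noncomputable def applyMat (K : Type) [Field K] {n : ℕ} (g : Matrix (Fin n) (Fin n) K)
    (I : Submodule K (ExtAlg K n)) : Submodule K (ExtAlg K n) :=
  Submodule.map (matAlgMap K g).toLinearMap I

/-- `J` is the generic initial ideal `Gin^E(I)` of `I`: there is a nonempty Zariski
open subset `U` of `GL(n;K)` (the nonvanishing locus of a nonzero polynomial in the
matrix entries) such that `in_{<rev}(φ(I)) = J` for every `φ ∈ U`. -/
def IsGinE {K : Type} [Field K] {n : ℕ} (I J : Submodule K (ExtAlg K n)) : Prop :=
  ∃ p : MvPolynomial (Fin n × Fin n) K, p ≠ 0 ∧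
    ∀ g : Matrix (Fin n) (Fin n) K, IsUnit g.det →
      MvPolynomial.eval (fun kl => g kl.1 kl.2) p ≠ 0 →
        initialIdealE K (applyMat K g I) = J

/-- `m_{≤i}(J, d)`: the number of monomials `e_σ ∈ J` of degree `d` with
`m(e_σ) = max σ ≤ i` (in the `1`-based labelling `[n] = {1, …, n}`). -/
noncomputable def mLeE {K : Type} [Field K] {n : ℕ} (J : Submodule K (ExtAlg K n))
    (i d : ℕ) : ℕ :=
  Nat.card {σ : Finset (Fin n) // σ.card = d ∧ (∀ k ∈ σ, (k : ℕ) < i) ∧ eMon K n σ ∈ J}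

open Classical in
/-- The matrix `M_τ(I,d)`: the submatrix of `M(I,d) = (α_a^σ)` consisting of the
columns indexed by the `d`-element subsets `σ` with `e_τ ≤_rev e_σ` (realized by
zeroing out all other columns, which does not change the rank). -/
noncomputable def MtauMatrix {K : Type} [Field K] {n : ℕ} {s : ℕ}
    (α : Fin s → Finset (Fin n) → K) (d : ℕ) (τ : Finset (Fin n)) :
    Matrix (Fin s) (Finset (Fin n)) K :=
  Matrix.of fun a σ => if σ.card = d ∧ τ.card = d ∧ revLexLe τ σ then α a σ else 0

open Classical in
/-- The matrix `M'_τ(I,d)`: the submatrix of `M_τ(I,d)` obtained by removing the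
column indexed by `τ` (realized by zeroing out all other columns). -/
noncomputable def MtauMatrix' {K : Type} [Field K] {n : ℕ} {s : ℕ}
    (α : Fin s → Finset (Fin n) → K) (d : ℕ) (τ : Finset (Fin n)) :
    Matrix (Fin s) (Finset (Fin n)) K :=
  Matrix.of fun a σ =>
    if σ.card = d ∧ τ.card = d ∧ revLexLe τ σ ∧ σ ≠ τ then α a σ else 0

/-- `f : Fin s → E` is a `K`-basis of the degree-`d` part `I_d = I ⊓ ⋀^d V` of `I`. -/
def IsBasisOfDegPart {K : Type} [Field K] {n : ℕ} (I : Submodule K (ExtAlg K n))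
    (d s : ℕ) (f : Fin s → ExtAlg K n) : Prop :=
  LinearIndependent K f ∧ Submodule.span K (Set.range f) = I ⊓ monSpan K n d

/-- `α` is the coefficient matrix of `φ(f_1), …, φ(f_s)` in the monomial basis:
`φ(f_a) = ∑_{|σ| = d} α_a^σ e_σ`. -/
def IsCoeffMatrix {K : Type} [Field K] {n : ℕ} (g : Matrix (Fin n) (Fin n) K)
    {s : ℕ} (f : Fin s → ExtAlg K n) (α : Fin s → Finset (Fin n) → K) (d : ℕ) : Prop :=
  ∀ a : Fin s, matAlgMap K g (f a) =
    ∑ σ ∈ Finset.univ.filter (fun σ : Finset (Fin n) => σ.card = d), α a σ • eMon K n σ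

/-- `σ_(i,d) = {i − d + 1, i − d + 2, …, i} ⊆ [n]` (in `1`-based labelling). -/
def sigmaSet (n i d : ℕ) : Finset (Fin n) :=
  Finset.univ.filter fun k : Fin n => i - d ≤ (k : ℕ) ∧ (k : ℕ) < i

open Classical in
/-- `C_{ij}(σ)`, the basic combinatorial shifting operation on a single face. -/
noncomputable def shiftFace {n : ℕ} (Δ : Set (Finset (Fin n))) (i j : Fin n)
    (σ : Finset (Fin n)) : Finset (Fin n) :=
  if i ∈ σ ∧ j ∉ σ ∧ insert j (σ.erase i) ∉ Δ then insert j (σ.erase i) else σ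

/-- `Shift_{ij}(Δ)`. -/
noncomputable def shiftOp {n : ℕ} (Δ : Set (Finset (Fin n))) (i j : Fin n) :
    Set (Finset (Fin n)) :=
  (shiftFace Δ i j) '' Δ

/-- A simplicial complex on `[n]`, modeled as a set of finsets of `Fin n`. -/
def IsSimplicialComplex {n : ℕ} (Δ : Set (Finset (Fin n))) : Prop :=
  (∀ j : Fin n, {j} ∈ Δ) ∧ ∀ σ ∈ Δ, ∀ τ : Finset (Fin n), τ ⊆ σ → τ ∈ Δ


/-- The basis of `E` consisting of the monomials `e_σ`. -/
noncomputable def monBasis (K : Type) [Field K] (n : ℕ) :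
    Module.Basis (Finset (Fin n)) K (ExtAlg K n) :=
  (Pi.basisFun K (Fin n)).ExteriorAlgebra

lemma monBasis_apply (K : Type) [Field K] (n : ℕ) (σ : Finset (Fin n)) :
    monBasis K n σ = eMon K n σ := by
  rw [monBasis, ExteriorAlgebra.basis_apply_ofCard _ rfl, ExteriorAlgebra.ιMulti_family,
    ExteriorAlgebra.ιMulti_apply, eMon]
  congr 1
  apply List.ext_getElem
  · simp
  · intro k h₁ h₂
    simp [Set.powersetCard.ofFinEmbEquiv_symm_apply, Finset.orderEmbOfFin_apply]

lemma monSpan_eq_exteriorPower (K : Type) [Field K] (n d : ℕ) :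
    monSpan K n d = ⋀[K]^d (Fin n → K) := by
  rw [← exteriorPower.ιMulti_family_span_fixedDegree_of_span K (Pi.basisFun K (Fin n)).span_eq]
  rw [monSpan]
  congr 1
  ext x
  constructor
  · rintro ⟨σ, hσ, rfl⟩
    exact ⟨Set.powersetCard.ofCard hσ, by
      rw [← monBasis_apply, monBasis, ExteriorAlgebra.basis_apply_ofCard _ hσ]⟩
  · rintro ⟨σ, rfl⟩
    exact ⟨σ, σ.2, by
      rw [← monBasis_apply, monBasis, ExteriorAlgebra.basis_apply_powersetCard]⟩

lemma matAlgMap_mem_monSpan {K : Type} [Field K] {n d : ℕ} (g : Matrix (Fin n) (Fin n) K)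
    {x : ExtAlg K n} (hx : x ∈ monSpan K n d) : matAlgMap K g x ∈ monSpan K n d := by
  rw [monSpan_eq_exteriorPower, ← ExteriorAlgebra.ιMulti_span_fixedDegree] at *
  induction hx using Submodule.span_induction with
  | mem x hx =>
    obtain ⟨v, rfl⟩ := hx
    rw [matAlgMap, ExteriorAlgebra.map_apply_ιMulti]
    exact Submodule.subset_span ⟨_, rfl⟩
  | zero => simp
  | add x y _ _ hx hy => rw [map_add]; exact add_mem hx hy
  | smul a x _ hx => rw [map_smul]; exact Submodule.smul_mem _ _ hx

lemma eMon_mul_eMon_of_not_disjoint (K : Type) [Field K] {n : ℕ} {σ τ : Finset (Fin n)}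
    (h : ¬ Disjoint σ τ) : eMon K n σ * eMon K n τ = 0 := by
  simp only [← monBasis_apply]
  exact ExteriorAlgebra.basis_mul_of_not_disjoint (Pi.basisFun K (Fin n))
    (Set.powersetCard.ofCard (s := σ) rfl) (Set.powersetCard.ofCard (s := τ) rfl) h

lemma eMon_mul_eMon_of_disjoint (K : Type) [Field K] {n : ℕ} {σ τ : Finset (Fin n)}
    (h : Disjoint σ τ) : ∃ u : ℤˣ, eMon K n σ * eMon K n τ = u • eMon K n (σ ∪ τ) := by
  simp only [← monBasis_apply]
  have hmul := ExteriorAlgebra.basis_mul_of_disjoint (Pi.basisFun K (Fin n))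
    (Set.powersetCard.ofCard (s := σ) rfl) (Set.powersetCard.ofCard (s := τ) rfl) h
  have hunion : (Set.powersetCard.disjUnion (s := Set.powersetCard.ofCard (s := σ) rfl)
      (t := Set.powersetCard.ofCard (s := τ) rfl) h : Finset (Fin n)) = σ ∪ τ := by
    ext
    simp [Set.powersetCard.disjUnion]
  rw [hunion] at hmul
  exact ⟨_, hmul⟩

lemma faceIdealE_eq_span (K : Type) [Field K] {n : ℕ} {Δ : Set (Finset (Fin n))}
    (hΔ : ∀ σ ∈ Δ, ∀ τ : Finset (Fin n), τ ⊆ σ → τ ∈ Δ) :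
    faceIdealE K Δ = Submodule.span K (eMon K n '' Δᶜ) := by
  have hmem : ∀ σ ∉ Δ, ∀ τ : Finset (Fin n), σ ⊆ τ →
      eMon K n τ ∈ Submodule.span K (eMon K n '' Δᶜ) := fun σ hσ τ hστ =>
    Submodule.subset_span ⟨τ, fun h => hσ (hΔ τ h σ hστ), rfl⟩
  have hspan : ⊤ ≤ Submodule.span K (Set.range (eMon K n)) := by
    rw [← (monBasis K n).span_eq, funext (monBasis_apply K n)]
  have hleft : ∀ (u : ExtAlg K n), ∀ x ∈ Submodule.span K (eMon K n '' Δᶜ),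
      u * x ∈ Submodule.span K (eMon K n '' Δᶜ) := by
    intro u x hx
    have hu : u ∈ Submodule.span K (Set.range (eMon K n)) := hspan trivial
    refine (Submodule.mul_le (P := Submodule.span K (eMon K n '' Δᶜ))).mp ?_ u hu x hx
    rw [Submodule.span_mul_span, Submodule.span_le]
    rintro _ ⟨_, ⟨ρ, rfl⟩, _, ⟨σ, hσ, rfl⟩, rfl⟩
    by_cases h : Disjoint ρ σ
    · obtain ⟨c, hc⟩ := eMon_mul_eMon_of_disjoint K h
      simp only [hc]
      exact Submodule.smul_of_tower_mem _ (c : ℤ) (hmem σ hσ _ Finset.subset_union_right)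
    · simp [eMon_mul_eMon_of_not_disjoint K h]
  have hright : ∀ (u : ExtAlg K n), ∀ x ∈ Submodule.span K (eMon K n '' Δᶜ),
      x * u ∈ Submodule.span K (eMon K n '' Δᶜ) := by
    intro u x hx
    have hu : u ∈ Submodule.span K (Set.range (eMon K n)) := hspan trivial
    refine (Submodule.mul_le (P := Submodule.span K (eMon K n '' Δᶜ))).mp ?_ x hx u hu
    rw [Submodule.span_mul_span, Submodule.span_le]
    rintro _ ⟨_, ⟨σ, hσ, rfl⟩, _, ⟨ρ, rfl⟩, rfl⟩
    by_cases h : Disjoint σ ρ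
    · obtain ⟨c, hc⟩ := eMon_mul_eMon_of_disjoint K h
      simp only [hc]
      exact Submodule.smul_of_tower_mem _ (c : ℤ) (hmem σ hσ _ Finset.subset_union_left)
    · simp [eMon_mul_eMon_of_not_disjoint K h]
  apply le_antisymm
  · rw [faceIdealE, idealSpanE, Submodule.span_le]
    rintro _ ⟨_, ⟨σ, hσ, rfl⟩, u, v, rfl⟩
    exact hright v _ (hleft u _ (hmem σ hσ σ subset_rfl))
  · rw [Submodule.span_le]
    rintro _ ⟨σ, hσ, rfl⟩
    exact Submodule.subset_span ⟨_, ⟨σ, hσ, rfl⟩, 1, 1, by simp⟩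

lemma mem_span_eMon_iff {K : Type} [Field K] {n : ℕ} {N : Set (Finset (Fin n))}
    {x : ExtAlg K n} : x ∈ Submodule.span K (eMon K n '' N) ↔
      ∀ σ, (monBasis K n).repr x σ ≠ 0 → σ ∈ N := by
  rw [← funext (monBasis_apply K n), Module.Basis.mem_span_image]
  simp [Set.subset_def]

lemma monSpan_eq_span_image (K : Type) [Field K] (n d : ℕ) :
    monSpan K n d = Submodule.span K (eMon K n '' {σ | σ.card = d}) := by
  rw [monSpan]
  congr 1
  ext x
  simp [eq_comm]

lemma faceIdealE_inf_monSpan (K : Type) [Field K] {n d : ℕ} {Δ : Set (Finset (Fin n))}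
    (hΔ : ∀ σ ∈ Δ, ∀ τ : Finset (Fin n), τ ⊆ σ → τ ∈ Δ) :
    faceIdealE K Δ ⊓ monSpan K n d =
      Submodule.span K (eMon K n '' {σ | σ ∉ Δ ∧ σ.card = d}) := by
  ext x
  rw [Submodule.mem_inf, faceIdealE_eq_span K hΔ, monSpan_eq_span_image]
  simp only [mem_span_eMon_iff]
  exact ⟨fun h σ hσ => ⟨h.1 σ hσ, h.2 σ hσ⟩, fun h => ⟨fun σ hσ => (h σ hσ).1,
    fun σ hσ => (h σ hσ).2⟩⟩

lemma repr_eMon (K : Type) [Field K] (n : ℕ) (σ : Finset (Fin n)) :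
    (monBasis K n).repr (eMon K n σ) = Finsupp.single σ 1 := by
  rw [← monBasis_apply, Module.Basis.repr_self]

lemma eMon_mem_span_iff (K : Type) [Field K] {n : ℕ} (N : Set (Finset (Fin n)))
    (σ : Finset (Fin n)) : eMon K n σ ∈ Submodule.span K (eMon K n '' N) ↔ σ ∈ N := by
  simp [mem_span_eMon_iff, repr_eMon, Finsupp.single_apply]

lemma mem_shiftOp_iff {n : ℕ} {Δ : Set (Finset (Fin n))} {i j : Fin n} (hij : i ≠ j)
    (ρ : Finset (Fin n)) : ρ ∈ shiftOp Δ i j ↔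
      if i ∈ ρ ∧ j ∉ ρ then ρ ∈ Δ ∧ insert j (ρ.erase i) ∈ Δ
      else if j ∈ ρ ∧ i ∉ ρ then ρ ∈ Δ ∨ insert i (ρ.erase j) ∈ Δ
      else ρ ∈ Δ := by
  have hswap : ∀ a b : Fin n, a ≠ b → ∀ σ : Finset (Fin n), a ∈ σ → b ∉ σ →
      insert a ((insert b (σ.erase a)).erase b) = σ := by
    intro a b hab σ ha hb
    rw [Finset.erase_insert (by simp [hb]), Finset.insert_erase ha]
  constructor
  · rintro ⟨σ, hσ, rfl⟩
    rw [shiftFace]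
    split_ifs <;> grind
  · intro h
    rw [shiftOp, Set.mem_image]
    split_ifs at h with h₁ h₂
    · exact ⟨ρ, h.1, by rw [shiftFace]; grind⟩
    · by_cases hρ : ρ ∈ Δ
      · exact ⟨ρ, hρ, by rw [shiftFace]; grind⟩
      · refine ⟨insert i (ρ.erase j), h.resolve_left hρ, ?_⟩
        have := hswap j i hij.symm ρ h₂.1 h₂.2
        rw [shiftFace]
        grind
    · exact ⟨ρ, h, by rw [shiftFace]; grind⟩

lemma shiftOp_subset_closed {n : ℕ} {Δ : Set (Finset (Fin n))}
    (hΔ : ∀ σ ∈ Δ, ∀ τ : Finset (Fin n), τ ⊆ σ → τ ∈ Δ) {i j : Fin n} (hij : i ≠ j) :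
    ∀ σ ∈ shiftOp Δ i j, ∀ τ : Finset (Fin n), τ ⊆ σ → τ ∈ shiftOp Δ i j := by
  intro σ hσ τ hτ
  rw [mem_shiftOp_iff hij] at hσ ⊢
  have hd₁ : σ ∈ Δ → τ ∈ Δ := fun h => hΔ σ h τ hτ
  have hd₂ : insert j (σ.erase i) ∈ Δ → insert j (τ.erase i) ∈ Δ := fun h =>
    hΔ _ h _ (Finset.insert_subset_insert _ (Finset.erase_subset_erase _ hτ))
  have hd₃ : insert i (σ.erase j) ∈ Δ → insert i (τ.erase j) ∈ Δ := fun h =>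
    hΔ _ h _ (Finset.insert_subset_insert _ (Finset.erase_subset_erase _ hτ))
  have hd₄ : insert j (σ.erase i) ∈ Δ → i ∉ τ → τ ∈ Δ := fun h _ => hΔ _ h _ (by grind)
  have hd₅ : insert i (σ.erase j) ∈ Δ → j ∉ τ → τ ∈ Δ := fun h _ => hΔ _ h _ (by grind)
  have hd₆ : σ ∈ Δ → j ∈ σ → insert j (τ.erase i) ∈ Δ := fun h _ => hΔ _ h _ (by grind)
  grind

/-- The linear endomorphism of `K^n` sending `e_j` to `e_i + c e_j` and fixing the other `e_k`. -/
noncomputable def mixMap (K : Type) [Field K] {n : ℕ} (i j : Fin n) (c : K) :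
    (Fin n → K) →ₗ[K] (Fin n → K) :=
  (Pi.basisFun K (Fin n)).constr K fun k =>
    if k = j then Pi.single i 1 + c • Pi.single j 1 else Pi.single k 1

lemma mixMap_single (K : Type) [Field K] {n : ℕ} (i j : Fin n) (c : K) (k : Fin n) :
    mixMap K i j c (Pi.single k 1) =
      if k = j then Pi.single i 1 + c • Pi.single j 1 else Pi.single k 1 := by
  have h := (Pi.basisFun K (Fin n)).constr_basis K
    (fun k => if k = j then Pi.single i (1 : K) + c • Pi.single j 1 else Pi.single k 1) k
  rwa [Pi.basisFun_apply] at h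

lemma eMon_singleton (K : Type) [Field K] {n : ℕ} (k : Fin n) :
    eMon K n {k} = ExteriorAlgebra.ι K (Pi.single k (1 : K)) := by
  simp [eMon]

lemma map_mixMap_eMon_of_notMem (K : Type) [Field K] {n : ℕ} {i j : Fin n} (c : K)
    {σ : Finset (Fin n)} (hj : j ∉ σ) :
    ExteriorAlgebra.map (mixMap K i j c) (eMon K n σ) = eMon K n σ := by
  rw [eMon, map_list_prod, List.map_map]
  congr 1
  refine List.map_congr_left fun k hk => ?_
  have hkj : k ≠ j := by
    rintro rfl
    exact hj (by simpa using hk)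
  simp [mixMap_single, hkj]

lemma eMon_singleton_mul_eMon {K : Type} [Field K] {n : ℕ} {k : Fin n} {σ : Finset (Fin n)}
    (hk : k ∉ σ) : ∃ ε : K, ε ≠ 0 ∧ eMon K n {k} * eMon K n σ = ε • eMon K n (insert k σ) := by
  obtain ⟨u, hu⟩ := eMon_mul_eMon_of_disjoint K (Finset.disjoint_singleton_left.mpr hk)
  rw [hu]
  obtain rfl | rfl := Int.units_eq_one_or u
  · exact ⟨1, one_ne_zero, by simp⟩
  · exact ⟨-1, by simp, by simp⟩

lemma map_mixMap_eMon_of_mem (K : Type) [Field K] {n : ℕ} {i j : Fin n} (hij : i ≠ j) (c : K)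
    {σ : Finset (Fin n)} (hi : i ∈ σ) (hj : j ∈ σ) :
    ExteriorAlgebra.map (mixMap K i j c) (eMon K n σ) = c • eMon K n σ := by
  obtain ⟨ε, hε, hmul⟩ := eMon_singleton_mul_eMon (K := K) (Finset.notMem_erase j σ)
  rw [Finset.insert_erase hj] at hmul
  have hzero : eMon K n {i} * eMon K n (σ.erase j) = 0 :=
    eMon_mul_eMon_of_not_disjoint K (by simp [hi, hij])
  have h := congrArg (ExteriorAlgebra.map (mixMap K i j c)) hmul
  rw [map_mul, map_mixMap_eMon_of_notMem K c (Finset.notMem_erase j σ), eMon_singleton,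
    ExteriorAlgebra.map_apply_ι, mixMap_single, if_pos rfl, map_add, map_smul, add_mul,
    ← eMon_singleton, ← eMon_singleton, hzero, zero_add, smul_mul_assoc, hmul, map_smul,
    smul_comm] at h
  exact (smul_right_injective _ hε h).symm

lemma map_mixMap_eMon_swap (K : Type) [Field K] {n : ℕ} {i j : Fin n}
    {σ : Finset (Fin n)} (hi : i ∉ σ) (hj : j ∈ σ) : ∃ ε : K, ε ≠ 0 ∧ ∀ c : K,
    ExteriorAlgebra.map (mixMap K i j c) (eMon K n σ) =
      ε • eMon K n (insert i (σ.erase j)) + c • eMon K n σ := by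
  obtain ⟨ε, hε, hmul⟩ := eMon_singleton_mul_eMon (K := K) (Finset.notMem_erase j σ)
  obtain ⟨η, hη, hmul'⟩ := eMon_singleton_mul_eMon (K := K)
    (fun h => hi (Finset.mem_of_mem_erase h) : i ∉ σ.erase j)
  rw [Finset.insert_erase hj] at hmul
  refine ⟨ε⁻¹ * η, mul_ne_zero (inv_ne_zero hε) hη, fun c => ?_⟩
  have h := congrArg (ExteriorAlgebra.map (mixMap K i j c)) hmul
  rw [map_mul, map_mixMap_eMon_of_notMem K c (Finset.notMem_erase j σ), eMon_singleton,
    ExteriorAlgebra.map_apply_ι, mixMap_single, if_pos rfl, map_add, map_smul, add_mul,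
    ← eMon_singleton, ← eMon_singleton, hmul', smul_mul_assoc, hmul, map_smul] at h
  rw [mul_smul, eq_comm]
  apply smul_right_injective _ hε
  simp only [smul_add, smul_inv_smul₀ hε, ← h, smul_comm c ε]

/-- The monomials outside `Shift_{ij}(Δ)` are limits, as `c → 0`, of elements of the image of the
span of the monomials outside `Δ` under `e_j ↦ e_i + c e_j`. -/
lemma exists_eMon_add_smul_mem (K : Type) [Field K] {n d : ℕ} {Δ : Set (Finset (Fin n))}
    {i j : Fin n} (hij : i ≠ j) {ρ : Finset (Fin n)} (hρ : ρ ∉ shiftOp Δ i j) (hd : ρ.card = d) :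
    ∃ x : ExtAlg K n, ∀ c : K, c ≠ 0 →
      ∃ y ∈ Submodule.span K (eMon K n '' {σ | σ ∉ Δ ∧ σ.card = d}),
        ExteriorAlgebra.map (mixMap K i j c) y = eMon K n ρ + c • x := by
  rw [mem_shiftOp_iff hij] at hρ
  have hcard : ∀ a b : Fin n, a ∈ ρ → b ∉ ρ → (insert b (ρ.erase a)).card = d := by
    intro a b ha hb
    rw [Finset.card_insert_of_notMem (by simp [hb]), Finset.card_erase_add_one ha, hd]
  by_cases hi : i ∈ ρ <;> by_cases hj : j ∈ ρ
  · refine ⟨0, fun c hc => ⟨c⁻¹ • eMon K n ρ, Submodule.smul_mem _ _ (Submodule.subset_span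
      ⟨ρ, ⟨by simpa [hi, hj] using hρ, hd⟩, rfl⟩), ?_⟩⟩
    rw [map_smul, map_mixMap_eMon_of_mem K hij c hi hj, inv_smul_smul₀ hc, smul_zero, add_zero]
  · by_cases hρΔ : ρ ∈ Δ
    · have hρ' : insert j (ρ.erase i) ∉ Δ := by simpa [hi, hj, hρΔ] using hρ
      have hback : insert i ((insert j (ρ.erase i)).erase j) = ρ := by
        rw [Finset.erase_insert (by simp [hj]), Finset.insert_erase hi]
      obtain ⟨ε, hε, h⟩ := map_mixMap_eMon_swap K (i := i) (j := j)
        (σ := insert j (ρ.erase i)) (by simp [hij]) (by simp)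
      refine ⟨ε⁻¹ • eMon K n (insert j (ρ.erase i)), fun c hc =>
        ⟨ε⁻¹ • eMon K n (insert j (ρ.erase i)), Submodule.smul_mem _ _ (Submodule.subset_span
          ⟨_, ⟨hρ', hcard i j hi hj⟩, rfl⟩), ?_⟩⟩
      rw [map_smul, h, hback, smul_add, inv_smul_smul₀ hε, smul_comm]
    · refine ⟨0, fun c hc => ⟨eMon K n ρ, Submodule.subset_span ⟨ρ, ⟨hρΔ, hd⟩, rfl⟩, ?_⟩⟩
      rw [map_mixMap_eMon_of_notMem K c hj, smul_zero, add_zero]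
  · have hρ' : ρ ∉ Δ ∧ insert i (ρ.erase j) ∉ Δ := by simpa [hi, hj] using hρ
    obtain ⟨ε, hε, h⟩ := map_mixMap_eMon_swap K hi hj
    refine ⟨0, fun c hc => ⟨c⁻¹ • (eMon K n ρ - ε • eMon K n (insert i (ρ.erase j))),
      Submodule.smul_mem _ _ (sub_mem (Submodule.subset_span ⟨ρ, ⟨hρ'.1, hd⟩, rfl⟩)
        (Submodule.smul_mem _ _ (Submodule.subset_span ⟨_, ⟨hρ'.2, hcard j i hj hi⟩, rfl⟩))),
      ?_⟩⟩
    rw [map_smul, map_sub, h, map_smul,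
      map_mixMap_eMon_of_notMem K c (σ := insert i (ρ.erase j)) (by simp [hij.symm]),
      add_sub_cancel_left, inv_smul_smul₀ hc, smul_zero, add_zero]
  · refine ⟨0, fun c hc => ⟨eMon K n ρ, Submodule.subset_span
      ⟨ρ, ⟨by simpa [hi, hj] using hρ, hd⟩, rfl⟩, ?_⟩⟩
    rw [map_mixMap_eMon_of_notMem K c hj, smul_zero, add_zero]

/-- `i` is the leading (largest) coordinate of some element of `W` in the basis `b`. -/
def IsLeading {K V ι : Type*} [Field K] [AddCommGroup V] [Module K V] [LT ι]
    (b : Module.Basis ι K V) (W : Submodule K V) (i : ι) : Prop :=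
  ∃ w ∈ W, b.repr w i ≠ 0 ∧ ∀ k, i < k → b.repr w k = 0

open Classical in
/-- The coordinate map with respect to `b` with the coordinates outside `S` set to zero. -/
noncomputable def truncRepr {K V ι : Type*} [Field K] [AddCommGroup V] [Module K V]
    (b : Module.Basis ι K V) (S : Set ι) : V →ₗ[K] (ι → K) :=
  LinearMap.pi fun i => if i ∈ S then b.coord i else 0

open Classical in
lemma truncRepr_apply {K V ι : Type*} [Field K] [AddCommGroup V] [Module K V]
    (b : Module.Basis ι K V) (S : Set ι) (v : V) (i : ι) :
    truncRepr b S v i = if i ∈ S then b.repr v i else 0 := by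
  rw [truncRepr, LinearMap.pi_apply]
  split_ifs <;> simp

/-- A choice of elements of `W`, one for each leading coordinate, spans `W`. -/
lemma le_span_of_isLeading {K V ι : Type*} [Field K] [AddCommGroup V] [Module K V]
    [LinearOrder ι] [Finite ι] (b : Module.Basis ι K V) (W : Submodule K V)
    (f : {i // IsLeading b W i} → V) (hfW : ∀ i, f i ∈ W) (hf : ∀ i, b.repr (f i) i ≠ 0)
    (hf' : ∀ (i : {i // IsLeading b W i}) (k : ι), (i : ι) < k → b.repr (f i) k = 0) :
    W ≤ Submodule.span K (Set.range f) := by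
  intro w hw
  induction hm : (b.repr w).support.max using WellFoundedLT.induction generalizing w with
  | ind m ih =>
    by_cases hw0 : w = 0
    · rw [hw0]
      exact zero_mem _
    have hne : (b.repr w).support.Nonempty := by simpa using hw0
    obtain ⟨i, hi⟩ := Finset.max_of_nonempty hne
    have hwi : b.repr w i ≠ 0 := Finsupp.mem_support_iff.mp (Finset.mem_of_max hi)
    have hwk : ∀ k, i < k → b.repr w k = 0 := by
      intro k hk
      by_contra h
      exact absurd (Finset.le_max_of_eq (Finsupp.mem_support_iff.mpr h) hi) (not_le.mpr hk)
    let i' : {i // IsLeading b W i} := ⟨i, w, hw, hwi, hwk⟩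
    have hfi : b.repr (f i') i ≠ 0 := hf i'
    let c := b.repr w i / b.repr (f i') i
    have hlt : (b.repr (w - c • f i')).support.max < m := by
      rw [← hm, hi, Finset.max, Finset.sup_lt_iff (WithBot.bot_lt_coe i)]
      intro k hk
      rw [WithBot.coe_lt_coe]
      by_contra! hik
      apply Finsupp.mem_support_iff.mp hk
      obtain rfl | hik := hik.eq_or_lt
      · simp [c, div_mul_cancel₀ _ hfi]
      · simp [hwk k hik, hf' i' k hik]
    have hsub := ih _ hlt (sub_mem hw (W.smul_mem c (hfW i'))) rfl
    have hadd := add_mem hsub (Submodule.smul_mem _ c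
      (Submodule.subset_span (Set.mem_range_self i')))
    rwa [sub_add_cancel] at hadd

/-- The rank of a truncation to an upper set counts the leading coordinates in that set. -/
lemma finrank_map_truncRepr {K V ι : Type*} [Field K] [AddCommGroup V] [Module K V]
    [LinearOrder ι] [Finite ι] (b : Module.Basis ι K V) (W : Submodule K V) {S : Set ι}
    (hS : IsUpperSet S) :
    Module.finrank K (W.map (truncRepr b S)) = Nat.card {i // IsLeading b W i ∧ i ∈ S} := by
  have : Fintype {i // IsLeading b W i ∧ i ∈ S} := Fintype.ofFinite _
  choose f hfW hf hf' using fun i : {i // IsLeading b W i} => i.2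
  let h : {i // IsLeading b W i ∧ i ∈ S} → ι → K := fun i => truncRepr b S (f ⟨i, i.2.1⟩)
  have hspan : W.map (truncRepr b S) = Submodule.span K (Set.range h) := by
    apply le_antisymm
    · refine (Submodule.map_mono (le_span_of_isLeading b W f hfW hf hf')).trans ?_
      rw [Submodule.map_span, Submodule.span_le]
      rintro _ ⟨_, ⟨i, rfl⟩, rfl⟩
      by_cases hi : (i : ι) ∈ S
      · exact Submodule.subset_span ⟨⟨i, i.2, hi⟩, rfl⟩
      · have hzero : truncRepr b S (f i) = 0 := by
          ext k
          rw [truncRepr_apply]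
          split_ifs with hk
          · exact hf' i k (lt_of_not_ge fun hle => hi (hS hle hk))
          · rfl
        rw [hzero]
        exact zero_mem _
    · rw [Submodule.span_le]
      rintro _ ⟨i, rfl⟩
      exact Submodule.mem_map_of_mem (hfW _)
  have hind : LinearIndependent K h := by
    classical
    rw [Fintype.linearIndependent_iff]
    intro c hc
    by_contra! hne
    obtain ⟨m, hm, hmax⟩ := (Finset.univ.filter fun i => c i ≠ 0).exists_maximal
      (by simpa [Finset.filter_nonempty_iff] using hne)
    have hcm := congrFun hc m
    rw [Finset.sum_apply, Finset.sum_eq_single m] at hcm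
    · simp only [Pi.smul_apply, h, truncRepr_apply, m.2.2, if_true, smul_eq_mul, Pi.zero_apply,
        mul_eq_zero] at hcm
      exact hcm.elim (by simpa using hm) (hf _)
    · intro k _ hkm
      by_cases hck : c k = 0
      · simp [hck]
      · have hlt : k < m := by
          refine lt_of_le_of_ne (le_of_not_gt fun hgt => ?_) hkm
          exact absurd (hmax (by simpa using hck) hgt.le) (not_le.mpr hgt)
        simp [h, truncRepr_apply, m.2.2, hf' ⟨k, k.2.1⟩ m hlt]
    · simp
  rw [hspan, finrank_span_eq_card hind, Nat.card_eq_fintype_card]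

lemma exists_linearMap_apply_eq_single {K F κ : Type*} [Field K] [AddCommGroup F] [Module K F]
    [Fintype κ] [DecidableEq κ] {v : κ → F} (hv : LinearIndependent K v) :
    ∃ T : F →ₗ[K] (κ → K), ∀ k, T (v k) = Pi.single k 1 := by
  obtain ⟨T, hT⟩ := (Fintype.linearCombination K v).exists_leftInverse_of_injective
    (LinearMap.ker_eq_bot.mpr hv.fintypeLinearCombination_injective)
  refine ⟨T, fun k => ?_⟩
  have h := LinearMap.congr_fun hT (Pi.single k 1)
  simpa [Fintype.linearCombination_apply_single] using h

lemma linearIndependent_of_det_ne_zero {K F κ : Type*} [Field K] [AddCommGroup F] [Module K F]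
    [Fintype κ] [DecidableEq κ] {w : κ → F} (T : F →ₗ[K] (κ → K))
    (h : (Matrix.of fun k l => T (w k) l).det ≠ 0) : LinearIndependent K w := by
  have := Matrix.linearIndependent_rows_of_det_ne_zero h
  exact LinearIndependent.of_comp T this

lemma exists_ne_zero_linearIndependent_add_smul {K F κ : Type*} [Field K] [Infinite K]
    [AddCommGroup F] [Module K F] [Fintype κ] [DecidableEq κ] {v : κ → F} (hv : LinearIndependent K v)
    (x : κ → F) : ∃ c : K, c ≠ 0 ∧ LinearIndependent K fun k => v k + c • x k := by
  obtain ⟨T, hT⟩ := exists_linearMap_apply_eq_single hv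
  let M : Matrix κ κ K := Matrix.of fun k l => T (x k) l
  let D : Polynomial K := (1 + (Polynomial.X : Polynomial K) • M.map Polynomial.C).det
  have hD : ∀ c, D.eval c = (Matrix.of fun k l => T (v k + c • x k) l).det := by
    intro c
    rw [← Polynomial.coe_evalRingHom, RingHom.map_det]
    congr 1
    ext k l
    simp [hT, M, Matrix.one_apply, Pi.single_apply, eq_comm, apply_ite]
    ring
  have hD0 : D.eval 0 ≠ 0 := by
    have : (Matrix.of fun k l => T (v k + (0 : K) • x k) l) = 1 := by
      ext k l
      simp [hT, Matrix.one_apply, Pi.single_apply, eq_comm]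
    rw [hD, this, Matrix.det_one]
    exact one_ne_zero
  have hne : Polynomial.X * D ≠ 0 :=
    mul_ne_zero Polynomial.X_ne_zero fun h => hD0 (by rw [h, Polynomial.eval_zero])
  obtain ⟨c, hc⟩ : ∃ c, (Polynomial.X * D).eval c ≠ 0 := by
    by_contra! h
    exact hne (Polynomial.funext (by simpa using h))
  rw [Polynomial.eval_mul, Polynomial.eval_X] at hc
  exact ⟨c, left_ne_zero_of_mul hc, linearIndependent_of_det_ne_zero T
    (hD c ▸ right_ne_zero_of_mul hc)⟩

/-- The linear order on monomials for which `σ ≤ ρ` means `e_σ ≤_rev e_ρ`. -/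
abbrev revLexOrder (n : ℕ) : LinearOrder (Finset (Fin n)) :=
  LinearOrder.lift' (fun σ => OrderDual.toDual (toColex σ)) fun _ _ h => h

lemma revLexLe_iff {n : ℕ} {τ σ : Finset (Fin n)} : revLexLe τ σ ↔ toColex σ ≤ toColex τ := by
  rw [revLexLe, le_iff_eq_or_lt, Finset.Colex.toColex_lt_toColex_iff_exists_forall_lt, toColex_inj,
    eq_comm]

lemma finrank_map_truncRepr_revLexLe (K : Type) [Field K] {n : ℕ} (W : Submodule K (ExtAlg K n))
    (τ : Finset (Fin n)) :
    Module.finrank K (W.map (truncRepr (monBasis K n) {σ | revLexLe τ σ})) =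
      Nat.card {σ // (∃ w ∈ W, (monBasis K n).repr w σ ≠ 0 ∧
        ∀ ρ, (monBasis K n).repr w ρ ≠ 0 → revLexLe ρ σ) ∧ revLexLe τ σ} := by
  refine (@finrank_map_truncRepr K (ExtAlg K n) (Finset (Fin n)) _ _ _ (revLexOrder n) _
    (monBasis K n) W {σ | revLexLe τ σ} ?_).trans
    (Nat.card_congr (Equiv.subtypeEquivRight fun σ => and_congr_left fun _ => ?_))
  · intro σ ρ hσρ hσ
    rw [Set.mem_ofPred_eq, revLexLe_iff] at hσ ⊢
    exact le_trans hσρ hσ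
  · refine exists_congr fun w => and_congr_right fun _ => and_congr_right fun _ =>
      forall_congr' fun ρ => ?_
    rw [revLexLe_iff, ← not_lt]
    exact ⟨fun h hρ hlt => hρ (h hlt), fun h hlt => by_contra fun hρ => h hρ hlt⟩

lemma isInitialMonomial_iff {K : Type} [Field K] {n : ℕ} {I : Submodule K (ExtAlg K n)}
    {σ : Finset (Fin n)} : IsInitialMonomial I σ ↔
      ∃ f ∈ I ⊓ monSpan K n σ.card, (monBasis K n).repr f σ ≠ 0 ∧
        ∀ ρ, (monBasis K n).repr f ρ ≠ 0 → revLexLe ρ σ := by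
  have hle : monSpanLe K σ =
      Submodule.span K (eMon K n '' {ρ | ρ.card = σ.card ∧ revLexLe ρ σ}) := by
    rw [monSpanLe]
    congr 1
    ext x
    simp [eq_comm, and_assoc]
  have hlt : monSpanLt K σ =
      Submodule.span K (eMon K n '' {ρ | ρ.card = σ.card ∧ revLexLe ρ σ ∧ ρ ≠ σ}) := by
    rw [monSpanLt]
    congr 1
    ext x
    simp [eq_comm, and_assoc]
  rw [IsInitialMonomial, hle, hlt, monSpan_eq_span_image]
  refine exists_congr fun f => ?_
  simp only [Submodule.mem_inf, mem_span_eMon_iff, Set.mem_ofPred_eq]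
  constructor
  · rintro ⟨hfI, hf, hf', -⟩
    refine ⟨⟨hfI, fun ρ hρ => (hf ρ hρ).1⟩, fun h0 => hf' fun ρ hρ => ?_, fun ρ hρ => (hf ρ hρ).2⟩
    exact ⟨(hf ρ hρ).1, (hf ρ hρ).2, fun h => hρ (h ▸ h0)⟩
  · rintro ⟨⟨hfI, hf⟩, h0, hf'⟩
    refine ⟨hfI, fun ρ hρ => ⟨hf ρ hρ, hf' ρ hρ⟩, fun h => (h σ h0).2.2 rfl, ?_⟩
    rintro rfl
    simp at h0

lemma eMon_mem_initialIdealE_iff {K : Type} [Field K] {n : ℕ} {I : Submodule K (ExtAlg K n)}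
    {σ : Finset (Fin n)} : eMon K n σ ∈ initialIdealE K I ↔ IsInitialMonomial I σ := by
  have h : initialIdealE K I = Submodule.span K (eMon K n '' {σ | IsInitialMonomial I σ}) := by
    rw [initialIdealE]
    congr 1
    ext x
    simp [eq_comm]
  rw [h, eMon_mem_span_iff, Set.mem_ofPred_eq]

lemma applyMat_inf_monSpan {K : Type} [Field K] {n : ℕ} {g : Matrix (Fin n) (Fin n) K}
    (hg : IsUnit g.det) (I : Submodule K (ExtAlg K n)) (d : ℕ) :
    applyMat K g I ⊓ monSpan K n d = applyMat K g (I ⊓ monSpan K n d) := by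
  apply le_antisymm
  · rintro _ ⟨⟨x, hx, rfl⟩, hgx⟩
    refine ⟨x, ⟨hx, ?_⟩, rfl⟩
    have hinv := matAlgMap_mem_monSpan g⁻¹ hgx
    have hcomp : matAlgMap K g⁻¹ (matAlgMap K g x) = x := by
      rw [matAlgMap, matAlgMap, ← AlgHom.comp_apply, ExteriorAlgebra.map_comp_map,
        ← Matrix.toLin'_mul, Matrix.nonsing_inv_mul _ hg, Matrix.toLin'_one,
        ExteriorAlgebra.map_id, AlgHom.id_apply]
    exact hcomp ▸ hinv
  · rintro _ ⟨x, ⟨hx, hxd⟩, rfl⟩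
    exact ⟨⟨x, hx, rfl⟩, matAlgMap_mem_monSpan g hxd⟩

lemma finrank_map_truncRepr_applyMat {K : Type} [Field K] {n : ℕ} {g : Matrix (Fin n) (Fin n) K}
    (hg : IsUnit g.det) (I : Submodule K (ExtAlg K n)) (d : ℕ) (τ : Finset (Fin n)) :
    Module.finrank K ((applyMat K g (I ⊓ monSpan K n d)).map
        (truncRepr (monBasis K n) {σ | revLexLe τ σ})) =
      Nat.card {σ // (σ.card = d ∧ eMon K n σ ∈ initialIdealE K (applyMat K g I)) ∧
        revLexLe τ σ} := by
  rw [finrank_map_truncRepr_revLexLe]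
  refine Nat.card_congr (Equiv.subtypeEquivRight fun σ => and_congr_left fun _ => ?_)
  rw [eMon_mem_initialIdealE_iff, isInitialMonomial_iff, ← applyMat_inf_monSpan hg]
  constructor
  · rintro ⟨w, hw, hσ, hlead⟩
    have hcard : σ.card = d := by
      have h := hw.2
      rw [monSpan_eq_span_image, SetLike.mem_coe, mem_span_eMon_iff] at h
      exact h σ hσ
    subst hcard
    exact ⟨rfl, w, hw, hσ, hlead⟩
  · rintro ⟨rfl, h⟩
    exact h

lemma rank_MtauMatrix {K : Type} [Field K] {n d s : ℕ} {I : Submodule K (ExtAlg K n)}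
    {g : Matrix (Fin n) (Fin n) K} {f : Fin s → ExtAlg K n} (hf : IsBasisOfDegPart I d s f)
    {α : Fin s → Finset (Fin n) → K} (hα : IsCoeffMatrix g f α d) {τ : Finset (Fin n)}
    (hτ : τ.card = d) :
    (MtauMatrix α d τ).rank = Module.finrank K ((applyMat K g (I ⊓ monSpan K n d)).map
        (truncRepr (monBasis K n) {σ | revLexLe τ σ})) := by
  have hrow : (MtauMatrix α d τ).row =
      fun a => truncRepr (monBasis K n) {σ | revLexLe τ σ} (matAlgMap K g (f a)) := by
    ext a σ
    rw [truncRepr_apply, hα a]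
    simp only [map_sum, map_smul, repr_eMon, Finsupp.coe_finsetSum, Finset.sum_apply,
      Finsupp.smul_apply, Finsupp.single_apply, smul_eq_mul, mul_ite, mul_one, mul_zero,
      Finset.sum_ite_eq', Finset.mem_filter, Finset.mem_univ, true_and, Matrix.row, MtauMatrix,
      Matrix.of_apply, hτ, Set.mem_ofPred_eq]
    split_ifs <;> tauto
  rw [Matrix.rank_eq_finrank_span_row, hrow, ← hf.2, applyMat, Submodule.map_span,
    Submodule.map_span, ← Set.range_comp, ← Set.range_comp]
  rfl

/-- The algebra of polynomial functions in the entries of a matrix. -/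
noncomputable def polyFun (K : Type) [Field K] (n : ℕ) :
    Subalgebra K (Matrix (Fin n) (Fin n) K → K) :=
  (MvPolynomial.aeval fun (kl : Fin n × Fin n) (g : Matrix (Fin n) (Fin n) K) =>
    g kl.1 kl.2).range

lemma exists_eval_eq_of_mem_polyFun {K : Type} [Field K] {n : ℕ}
    {F : Matrix (Fin n) (Fin n) K → K} (hF : F ∈ polyFun K n) :
    ∃ p : MvPolynomial (Fin n × Fin n) K,
      ∀ g : Matrix (Fin n) (Fin n) K, MvPolynomial.eval (fun kl => g kl.1 kl.2) p = F g := by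
  obtain ⟨p, rfl⟩ := hF
  refine ⟨p, fun g => ?_⟩
  have h : (Pi.evalAlgHom K (fun _ : Matrix (Fin n) (Fin n) K => K) g).comp
      (MvPolynomial.aeval fun (kl : Fin n × Fin n) (g : Matrix (Fin n) (Fin n) K) => g kl.1 kl.2) =
      MvPolynomial.aeval fun kl => g kl.1 kl.2 := by
    ext kl
    simp
  simpa [MvPolynomial.aeval_eq_eval] using (DFunLike.congr_fun h p).symm

lemma entry_mem_polyFun (K : Type) [Field K] {n : ℕ} (k l : Fin n) :
    (fun g : Matrix (Fin n) (Fin n) K => g k l) ∈ polyFun K n :=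
  ⟨MvPolynomial.X (k, l), by simp⟩

lemma det_mem_polyFun {K κ : Type} [Field K] [Fintype κ] [DecidableEq κ] {n : ℕ}
    {F : κ → κ → Matrix (Fin n) (Fin n) K → K} (hF : ∀ a b, F a b ∈ polyFun K n) :
    (fun g => (Matrix.of fun a b => F a b g).det) ∈ polyFun K n := by
  have h : (fun g => (Matrix.of fun a b => F a b g).det) =
      ∑ π : Equiv.Perm κ, (π.sign : ℤ) • ∏ a, F (π a) a := by
    ext g
    simp [Matrix.det_apply, Units.smul_def]
  rw [h]
  exact sum_mem fun π _ => zsmul_mem (prod_mem fun a _ => hF _ _) _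

lemma repr_matAlgMap_mem_polyFun (K : Type) [Field K] {n : ℕ} (y : ExtAlg K n)
    (σ : Finset (Fin n)) :
    (fun g => (monBasis K n).repr (matAlgMap K g y) σ) ∈ polyFun K n := by
  induction y using ExteriorAlgebra.induction generalizing σ with
  | algebraMap r =>
    simp only [AlgHom.commutes]
    exact (polyFun K n).algebraMap_mem _
  | ι v =>
    have h : (fun g => (monBasis K n).repr (matAlgMap K g (ExteriorAlgebra.ι K v)) σ) =
        ∑ k, ∑ l, ((v l) * (monBasis K n).repr (ExteriorAlgebra.ι K (Pi.single k 1)) σ) •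
          fun g : Matrix (Fin n) (Fin n) K => g k l := by
      ext g
      have hv : g.mulVec v = ∑ k, (∑ l, g k l * v l) • Pi.single k (1 : K) := by
        ext m
        simp [Finset.sum_apply, Pi.single_apply, Matrix.mulVec, dotProduct]
      rw [matAlgMap, ExteriorAlgebra.map_apply_ι, Matrix.toLin'_apply, hv]
      simp only [map_sum, map_smul, Finsupp.coe_finsetSum, Finset.sum_apply, Finsupp.smul_apply,
        smul_eq_mul, Pi.smul_apply, Finset.sum_mul]
      exact Finset.sum_congr rfl fun k _ => Finset.sum_congr rfl fun l _ => by ring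
    rw [h]
    exact sum_mem fun k _ => sum_mem fun l _ => Subalgebra.smul_mem _ (entry_mem_polyFun K k l) _
  | mul x y hx hy =>
    have h : (fun g => (monBasis K n).repr (matAlgMap K g (x * y)) σ) =
        ∑ ρ, ∑ τ, ((monBasis K n).repr (eMon K n ρ * eMon K n τ) σ) •
          ((fun g => (monBasis K n).repr (matAlgMap K g x) ρ) *
            fun g => (monBasis K n).repr (matAlgMap K g y) τ) := by
      ext g
      conv_lhs => rw [map_mul, ← (monBasis K n).sum_repr (matAlgMap K g x),
        ← (monBasis K n).sum_repr (matAlgMap K g y)]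
      simp only [Finset.sum_mul_sum, map_sum, smul_mul_smul_comm, map_smul,
        Finsupp.coe_finsetSum, Finset.sum_apply, Finsupp.smul_apply, smul_eq_mul, Pi.smul_apply,
        Pi.mul_apply, monBasis_apply, mul_comm]
    rw [h]
    exact sum_mem fun ρ _ => sum_mem fun τ _ => Subalgebra.smul_mem _ (mul_mem (hx ρ) (hy τ)) _
  | add x y hx hy =>
    simpa [map_add] using! add_mem (hx σ) (hy σ)

/-- Linear independence of finitely many coordinate vectors persists at a generic matrix. -/
lemma exists_generic_linearIndependent {K κ : Type} [Field K] [Infinite K] [Fintype κ] {n : ℕ}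
    {p : MvPolynomial (Fin n × Fin n) K} (hp : p ≠ 0) (S : Set (Finset (Fin n)))
    (y : κ → ExtAlg K n) (A : Matrix (Fin n) (Fin n) K)
    (hA : LinearIndependent K fun k => truncRepr (monBasis K n) S (matAlgMap K A (y k))) :
    ∃ g : Matrix (Fin n) (Fin n) K, IsUnit g.det ∧
      MvPolynomial.eval (fun kl => g kl.1 kl.2) p ≠ 0 ∧
      LinearIndependent K fun k => truncRepr (monBasis K n) S (matAlgMap K g (y k)) := by
  classical
  obtain ⟨T, hT⟩ := exists_linearMap_apply_eq_single hA
  have htrunc : ∀ x σ, (fun g => truncRepr (monBasis K n) S (matAlgMap K g x) σ) ∈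
      polyFun K n := by
    intro x σ
    simp only [truncRepr_apply]
    split_ifs
    · exact repr_matAlgMap_mem_polyFun K x σ
    · exact zero_mem _
  have hentry : ∀ k l, (fun g => T (truncRepr (monBasis K n) S (matAlgMap K g (y k))) l) ∈
      polyFun K n := by
    intro k l
    have h : (fun g => T (truncRepr (monBasis K n) S (matAlgMap K g (y k))) l) =
        ∑ σ, (T (Pi.single σ 1) l) •
          fun g => truncRepr (monBasis K n) S (matAlgMap K g (y k)) σ := by
      ext g
      have hw (w : Finset (Fin n) → K) : w = ∑ σ, w σ • Pi.single σ (1 : K) := by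
        ext ρ
        simp [Finset.sum_apply, Pi.single_apply]
      conv_lhs => rw [hw (truncRepr (monBasis K n) S (matAlgMap K g (y k)))]
      simp only [map_sum, map_smul, Finset.sum_apply, Pi.smul_apply, smul_eq_mul, mul_comm]
    rw [h]
    exact sum_mem fun σ _ => Subalgebra.smul_mem _ (htrunc (y k) σ) _
  obtain ⟨q, hq⟩ := exists_eval_eq_of_mem_polyFun (det_mem_polyFun hentry)
  obtain ⟨δ, hδ⟩ := exists_eval_eq_of_mem_polyFun
    (det_mem_polyFun (K := K) (n := n) fun k l => entry_mem_polyFun K k l)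
  have hq0 : q ≠ 0 := by
    rintro rfl
    have h := hq A
    have hone : (Matrix.of fun k l =>
        T (truncRepr (monBasis K n) S (matAlgMap K A (y k))) l) = 1 := by
      ext k l
      simp [hT, Matrix.one_apply, Pi.single_apply, eq_comm]
    rw [hone, Matrix.det_one, map_zero] at h
    exact zero_ne_one h
  have hδ0 : δ ≠ 0 := by
    rintro rfl
    have h := hδ 1
    rw [map_zero] at h
    exact zero_ne_one (h.trans Matrix.det_one)
  obtain ⟨x, hx⟩ : ∃ x, MvPolynomial.eval x (p * q * δ) ≠ 0 := by
    by_contra! h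
    exact mul_ne_zero (mul_ne_zero hp hq0) hδ0 (MvPolynomial.funext (by simpa using h))
  rw [map_mul, map_mul] at hx
  let g : Matrix (Fin n) (Fin n) K := Matrix.of fun k l => x (k, l)
  refine ⟨g, isUnit_iff_ne_zero.mpr ?_, left_ne_zero_of_mul (left_ne_zero_of_mul hx),
    linearIndependent_of_det_ne_zero T ?_⟩
  · exact hδ g ▸ right_ne_zero_of_mul hx
  · exact hq g ▸ right_ne_zero_of_mul (left_ne_zero_of_mul hx)

/-- **Lemma 2.5.** Let `Δ` be a simplicial complex on `[n]`, `1 ≤ i < j ≤ n`, and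
`σ_(i,d) = {i−d+1, …, i}`. Then
`rank(M_{σ_(i,d)}(J_{Shift_{ij}(Δ)}, d)) ≤ rank(M_{σ_(i,d)}(J_Δ, d))`. -/
theorem rank_Mtau_shiftOp_le (K : Type) [Field K] [Infinite K] (n : ℕ)
    (Δ : Set (Finset (Fin n))) (hΔ : IsSimplicialComplex Δ)
    (i j : Fin n) (hij : i < j) (d : ℕ)
    -- data computing `M_{σ_(i,d)}(J_Δ, d)`
    (J : Submodule K (ExtAlg K n)) (hGin : IsGinE (faceIdealE K Δ) J)
    (g : Matrix (Fin n) (Fin n) K) (hg : IsUnit g.det)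
    (hin : initialIdealE K (applyMat K g (faceIdealE K Δ)) = J)
    (s : ℕ) (f : Fin s → ExtAlg K n) (hf : IsBasisOfDegPart (faceIdealE K Δ) d s f)
    (α : Fin s → Finset (Fin n) → K) (hα : IsCoeffMatrix g f α d)
    -- data computing `M_{σ_(i,d)}(J_{Shift_{ij}(Δ)}, d)`
    (J' : Submodule K (ExtAlg K n)) (hGin' : IsGinE (faceIdealE K (shiftOp Δ i j)) J')
    (g' : Matrix (Fin n) (Fin n) K) (hg' : IsUnit g'.det)
    (hin' : initialIdealE K (applyMat K g' (faceIdealE K (shiftOp Δ i j))) = J')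
    (s' : ℕ) (f' : Fin s' → ExtAlg K n)
    (hf' : IsBasisOfDegPart (faceIdealE K (shiftOp Δ i j)) d s' f')
    (α' : Fin s' → Finset (Fin n) → K) (hα' : IsCoeffMatrix g' f' α' d) :
    (MtauMatrix α' d (sigmaSet n ((i : ℕ) + 1) d)).rank ≤
      (MtauMatrix α d (sigmaSet n ((i : ℕ) + 1) d)).rank := by
  classical
  set τ := sigmaSet n ((i : ℕ) + 1) d
  by_cases hτ : τ.card = d
  swap
  · have hzero : MtauMatrix α' d τ = 0 := by
      ext a σ
      simp [MtauMatrix, hτ]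
    rw [hzero, Matrix.rank_zero]
    exact Nat.zero_le _
  obtain ⟨p, hp, hpJ⟩ := hGin
  rw [rank_MtauMatrix hf hα hτ, rank_MtauMatrix hf' hα' hτ]
  let P := truncRepr (monBasis K n) {σ | revLexLe τ σ}
  let v : {σ // σ ∉ shiftOp Δ i j ∧ σ.card = d} → Finset (Fin n) → K :=
    fun σ => P (matAlgMap K g' (eMon K n σ))
  have hspan : (applyMat K g' (faceIdealE K (shiftOp Δ i j) ⊓ monSpan K n d)).map P =
      Submodule.span K (Set.range v) := by
    rw [faceIdealE_inf_monSpan K (shiftOp_subset_closed hΔ.2 hij.ne), applyMat,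
      Submodule.map_span, Submodule.map_span, Set.image_image, Set.image_image,
      Set.image_eq_range]
    rfl
  obtain ⟨κ, a, ha, haspan, hind⟩ := exists_linearIndependent' K v
  have : Finite κ := Finite.of_injective a ha
  have : Fintype κ := Fintype.ofFinite κ
  choose x hx using fun k : κ =>
    exists_eMon_add_smul_mem K (d := d) hij.ne (a k).2.1 (a k).2.2
  obtain ⟨c, hc, hcind⟩ := exists_ne_zero_linearIndependent_add_smul hind
    fun k => P (matAlgMap K g' (x k))
  choose y hy hyx using fun k => hx k c hc
  rw [← faceIdealE_inf_monSpan K hΔ.2] at hy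
  let A := LinearMap.toMatrix' (Matrix.toLin' g' ∘ₗ mixMap K i j c)
  have hAy : ∀ k, matAlgMap K A (y k) = matAlgMap K g' (eMon K n (a k) + c • x k) := by
    intro k
    rw [← hyx, matAlgMap, matAlgMap, ← AlgHom.comp_apply, ExteriorAlgebra.map_comp_map,
      Matrix.toLin'_toMatrix']
  obtain ⟨g₀, hg₀, hpg₀, hg₀ind⟩ := exists_generic_linearIndependent hp {σ | revLexLe τ σ} y A
    (by simpa only [hAy, map_add, map_smul] using! hcind)
  have hrank : Module.finrank K ((applyMat K g (faceIdealE K Δ ⊓ monSpan K n d)).map P) =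
      Module.finrank K ((applyMat K g₀ (faceIdealE K Δ ⊓ monSpan K n d)).map P) := by
    rw [finrank_map_truncRepr_applyMat hg, finrank_map_truncRepr_applyMat hg₀, hin,
      hpJ g₀ hg₀ hpg₀]
  calc Module.finrank K ((applyMat K g' (faceIdealE K (shiftOp Δ i j) ⊓ monSpan K n d)).map P)
      = Fintype.card κ := by rw [hspan, ← haspan, finrank_span_eq_card hind]
    _ = Module.finrank K (Submodule.span K (Set.range fun k => P (matAlgMap K g₀ (y k)))) :=
        (finrank_span_eq_card hg₀ind).symm
    _ ≤ Module.finrank K ((applyMat K g₀ (faceIdealE K Δ ⊓ monSpan K n d)).map P) := by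
        refine Submodule.finrank_mono (Submodule.span_le.mpr ?_)
        rintro _ ⟨k, rfl⟩
        exact Submodule.mem_map_of_mem (Submodule.mem_map_of_mem (hy k))
    _ = _ := hrank.symm
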